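/- Let G be a 2-connected graph which is not a cycle. If G contains no induced subgraph isomorphic to K_{1,3} and no induced subgraph isomorphic to P_5, then G is pancyclic. -/

import Mathlib

open SimpleGraph

/-- `G` contains a cycle of length `k`. -/
def HasCycleLength {V : Type} (G : SimpleGraph V) (k : ℕ) : Prop :=
  ∃ (v : V) (c : G.Walk v v), c.IsCycle ∧ c.length = k

/-- A graph on `n` vertices is pancyclic if it contains cycles of every length from 3 to `n`. -/
def IsPancyclic {V : Type} [Fintype V] (G : SimpleGraph V) : Prop :=
  ∀ k : ℕ, 3 ≤ k → k ≤ Fintype.card V → HasCycleLength G k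

/-- A graph is Hamiltonian if it contains a spanning cycle. -/
def IsHamiltonianGraph {V : Type} (G : SimpleGraph V) : Prop :=
  ∃ (v : V) (c : G.Walk v v), c.IsCycle ∧ ∀ u : V, u ∈ c.support

/-- A graph is 2-connected if it has at least 3 vertices and deleting any single
vertex leaves a connected graph. -/
def TwoConnected {V : Type} [Fintype V] (G : SimpleGraph V) : Prop :=
  3 ≤ Fintype.card V ∧ ∀ v : V, (G.induce {u : V | u ≠ v}).Connected

/-- A (finite) graph is a cycle iff it is connected and 2-regular. -/
def IsCycleGraph {V : Type} [Fintype V] (G : SimpleGraph V) [DecidableRel G.Adj] : Prop :=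
  G.Connected ∧ ∀ v : V, G.degree v = 2

/-- `G` is `R`-f₁-heavy: for every induced copy of `R` in `G` (given by a graph
embedding `f : R ↪g G`) and every pair of vertices at distance 2 in that copy,
one of them has degree at least `(n+1)/2` in `G`. -/
def F1Heavy {V W : Type} [Fintype V] (G : SimpleGraph V) [DecidableRel G.Adj]
    (R : SimpleGraph W) : Prop :=
  ∀ (f : R ↪g G) (a b : W), R.dist a b = 2 →
    Fintype.card V + 1 ≤ 2 * max (G.degree (f a)) (G.degree (f b))

/-- `G` is `R`-f-heavy: as above but with degree at least `n/2`. -/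
def FHeavy {V W : Type} [Fintype V] (G : SimpleGraph V) [DecidableRel G.Adj]
    (R : SimpleGraph W) : Prop :=
  ∀ (f : R ↪g G) (a b : W), R.dist a b = 2 →
    Fintype.card V ≤ 2 * max (G.degree (f a)) (G.degree (f b))

/-- `G` is `R`-free: no induced subgraph of `G` is isomorphic to `R`. -/
def RFree {V W : Type} (G : SimpleGraph V) (R : SimpleGraph W) : Prop :=
  IsEmpty (R ↪g G)

/-- The claw `K_{1,3}`: vertex `0` is the center, adjacent to `1`, `2`, `3`. -/
def claw : SimpleGraph (Fin 4) := SimpleGraph.fromRel (fun a _ => a = 0)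

/-- `Z_i`: the path `0 1 2 ... (i+2)` together with the chord `{0,2}`,
i.e. a triangle `0 1 2` with a path of `i` edges attached at vertex `2`. -/
def Zgraph (i : ℕ) : SimpleGraph (Fin (i + 3)) :=
  SimpleGraph.fromRel (fun a b => b.val = a.val + 1 ∨ (a.val = 0 ∧ b.val = 2))

/-- The net `N`: triangle `0 1 2` with pendant edges `0-3`, `1-4`, `2-5`. -/
def netGraph : SimpleGraph (Fin 6) :=
  SimpleGraph.fromRel (fun a b =>
    (a.val = 0 ∧ b.val = 1) ∨ (a.val = 1 ∧ b.val = 2) ∨ (a.val = 0 ∧ b.val = 2) ∨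
    (a.val = 0 ∧ b.val = 3) ∨ (a.val = 1 ∧ b.val = 4) ∨ (a.val = 2 ∧ b.val = 5))

/-- The wounded `W`: triangle `0 1 2` with a pendant edge `0-3` and a pendant
path `1-4-5` of two edges. -/
def woundedGraph : SimpleGraph (Fin 6) :=
  SimpleGraph.fromRel (fun a b =>
    (a.val = 0 ∧ b.val = 1) ∨ (a.val = 1 ∧ b.val = 2) ∨ (a.val = 0 ∧ b.val = 2) ∨
    (a.val = 0 ∧ b.val = 3) ∨ (a.val = 1 ∧ b.val = 4) ∨ (a.val = 4 ∧ b.val = 5))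

/-- A list of distinct vertices, cyclically consecutive ones adjacent. -/
def CycL {V : Type} (G : SimpleGraph V) (l : List V) : Prop :=
  l.Nodup ∧ l.IsChain G.Adj ∧ ∀ a ∈ l.getLast?, ∀ b ∈ l.head?, G.Adj a b

theorem CycL.rotate {V : Type} {G : SimpleGraph V} {l₁ l₂ : List V}
    (h : CycL G (l₁ ++ l₂)) : CycL G (l₂ ++ l₁) := by
  obtain ⟨h1, h2, h3⟩ := h
  refine ⟨List.nodup_append_comm.1 h1, ?_, ?_⟩
  · rw [List.isChain_append] at h2 ⊢
    refine ⟨h2.2.1, h2.1, fun a ha b hb => h3 a ?_ b ?_⟩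
    · simp_all
    · simp_all
  · intro a ha b hb
    rw [List.isChain_append] at h2
    cases l₁ with
    | nil => exact h3 a (by simpa using ha) b (by simpa using hb)
    | cons c l₁ =>
      cases l₂ with
      | nil => exact h3 a (by simpa using ha) b (by simpa using hb)
      | cons d l₂ =>
        refine h2.2.2 a ?_ b (by simpa using hb)
        simpa [List.getLast?_cons] using ha

theorem isChain_rev {V : Type} {G : SimpleGraph V} {l : List V} :
    l.reverse.IsChain G.Adj ↔ l.IsChain G.Adj := by
  rw [List.isChain_reverse]
  simp only [G.adj_comm]

theorem exists_walk_of_chain {V : Type} {G : SimpleGraph V} : ∀ (L : List V) (a : V),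
    (a :: L).IsChain G.Adj → ∃ b, (a :: L).getLast? = some b ∧
      ∃ p : G.Walk a b, p.support = a :: L
  | [], a, _ => ⟨a, by simp, Walk.nil, by simp⟩
  | c :: L, a, h => by
    rw [List.isChain_cons_cons] at h
    obtain ⟨b, hb, p, hp⟩ := exists_walk_of_chain L c h.2
    refine ⟨b, by simpa [List.getLast?_cons_cons] using hb, Walk.cons h.1 p, by simp [hp]⟩

theorem hasCycle_of_cycL {V : Type} {G : SimpleGraph V} {l : List V}
    (h : CycL G l) (h3 : 3 ≤ l.length) : HasCycleLength G l.length := by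
  obtain ⟨hn, hc, hl⟩ := h
  match l, h3 with
  | a :: c :: L, h3 =>
    rw [List.isChain_cons_cons] at hc
    obtain ⟨b, hb, p, hp⟩ := exists_walk_of_chain L c hc.2
    have hba : G.Adj b a := hl b (by simpa [List.getLast?_cons_cons] using hb) a (by simp)
    have hpp : p.IsPath := by
      rw [Walk.isPath_def, hp]; exact (List.nodup_cons.1 hn).2
    have hap : a ∉ p.support := by
      rw [hp]; exact (List.nodup_cons.1 hn).1
    refine ⟨b, Walk.cons hba (Walk.cons hc.1 p), ?_, ?_⟩
    · rw [Walk.cons_isCycle_iff]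
      refine ⟨by simp [Walk.cons_isPath_iff, hpp, hap], ?_⟩
      rw [Walk.edges_cons, List.mem_cons]
      rintro (h | h)
      · have : b = c := by
          rcases Sym2.eq_iff.1 h with h | h
          · exact absurd h.2 hc.1.ne
          · exact h.1
        subst this
        have hpp := Walk.eq_nil_iff_nil.2 (Walk.isPath_iff_nil.1 hpp)
        subst hpp
        simp at hp
        subst hp
        simp at h3
      · exact hap (Walk.snd_mem_support_of_mem_edges p h)
    · have := p.length_support
      rw [hp] at this
      simp at this ⊢
      omega

theorem claw_use {V : Type} {G : SimpleGraph V} (h : RFree G claw) {c x y z : V}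
    (hx : G.Adj c x) (hy : G.Adj c y) (hz : G.Adj c z) (xy : x ≠ y) (xz : x ≠ z) (yz : y ≠ z) :
    G.Adj x y ∨ G.Adj x z ∨ G.Adj y z := by
  by_contra! hh
  obtain ⟨h1, h2, h3⟩ := hh
  have h1' := mt G.adj_symm h1
  have h2' := mt G.adj_symm h2
  have h3' := mt G.adj_symm h3
  refine h.false ⟨⟨![c, x, y, z], ?_⟩, ?_⟩
  · intro i j
    fin_cases i <;> fin_cases j <;>
      simp [hx.ne, hy.ne, hz.ne, hx.ne', hy.ne', hz.ne', xy, xz, yz, xy.symm, xz.symm, yz.symm]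
  · intro i j
    change G.Adj (![c, x, y, z] i) (![c, x, y, z] j) ↔ _
    fin_cases i <;> fin_cases j <;>
      simp [claw, hx, hy, hz, hx.symm, hy.symm, hz.symm, h1, h2, h3, h1', h2', h3']

theorem p5_use {V : Type} {G : SimpleGraph V} (h : RFree G (pathGraph 5)) {a b c d e : V}
    (ab : G.Adj a b) (bc : G.Adj b c) (cd : G.Adj c d) (de : G.Adj d e)
    (ac : ¬ G.Adj a c) (ad : ¬ G.Adj a d) (ae : ¬ G.Adj a e)
    (bd : ¬ G.Adj b d) (be : ¬ G.Adj b e) (ce : ¬ G.Adj c e) : False := by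
  have ac' := mt G.adj_symm ac
  have ad' := mt G.adj_symm ad
  have ae' := mt G.adj_symm ae
  have bd' := mt G.adj_symm bd
  have be' := mt G.adj_symm be
  have ce' := mt G.adj_symm ce
  have n1 : a ≠ c := by rintro rfl; exact ad cd
  have n2 : a ≠ d := by rintro rfl; exact ae de
  have n3 : a ≠ e := by rintro rfl; exact ad de.symm
  have n4 : b ≠ d := by rintro rfl; exact be de
  have n5 : b ≠ e := by rintro rfl; exact ae ab
  have n6 : c ≠ e := by rintro rfl; exact be bc
  refine h.false ⟨⟨![a, b, c, d, e], ?_⟩, ?_⟩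
  · intro i j
    fin_cases i <;> fin_cases j <;>
      simp [ab.ne, bc.ne, cd.ne, de.ne, ab.ne', bc.ne', cd.ne', de.ne', n1, n2, n3, n4, n5, n6,
        n1.symm, n2.symm, n3.symm, n4.symm, n5.symm, n6.symm]
  · intro i j
    change G.Adj (![a, b, c, d, e] i) (![a, b, c, d, e] j) ↔ _
    fin_cases i <;> fin_cases j <;>
      simp [pathGraph_adj, ab, bc, cd, de, ab.symm, bc.symm, cd.symm, de.symm,
        ac, ad, ae, bd, be, ce, ac', ad', ae', bd', be', ce']

theorem cut_edge {V : Type} [Fintype V] {G : SimpleGraph V} (h2 : TwoConnected G) (u : V)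
    (S : V → Prop) {a b : V} (ha : S a) (hb : ¬ S b) (hau : a ≠ u) (hbu : b ≠ u) :
    ∃ c d, S c ∧ ¬ S d ∧ c ≠ u ∧ d ≠ u ∧ G.Adj c d := by
  by_contra! hcon
  obtain ⟨p⟩ := (h2.2 u).preconnected ⟨a, hau⟩ ⟨b, hbu⟩
  have key : ∀ (x y : {w : V | w ≠ u}) (q : (G.induce {w : V | w ≠ u}).Walk x y),
      S x.1 → S y.1 := by
    intro x y q
    induction q with
    | nil => exact id
    | @cons x y z hxy q ih =>
      intro hx
      refine ih ?_
      by_contra hy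
      exact hcon _ _ hx hy x.2 y.2 hxy
  exact hb (key _ _ p ha)

theorem exists_last {V : Type} (P : V → Prop) : ∀ (L : List V), (∃ a ∈ L, P a) →
    ∃ A v B, L = A ++ v :: B ∧ P v ∧ ∀ b ∈ B, ¬ P b
  | [], h => by simp at h
  | c :: L, h => by
    by_cases hL : ∃ a ∈ L, P a
    · obtain ⟨A, v, B, h1, h2, h3⟩ := exists_last P L hL
      exact ⟨c :: A, v, B, by simp [h1], h2, h3⟩
    · push Not at hL
      refine ⟨[], c, L, by simp, ?_, hL⟩
      obtain ⟨a, ha, hPa⟩ := h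
      rcases List.mem_cons.1 ha with rfl | h
      · exact hPa
      · exact absurd hPa (hL a h)

theorem closed_forward {V : Type} {G : SimpleGraph V} (P : V → Prop) :
    ∀ (B : List V) (a : V), (a :: B).IsChain G.Adj → P a →
    (∀ c ∈ a :: B, ∀ w ∈ a :: B, P c → G.Adj c w → P w) → ∀ b ∈ B, P b
  | [], a, _, _, _ => by simp
  | c :: B, a, hc, ha, hcl => by
    rw [List.isChain_cons_cons] at hc
    have hPc : P c := hcl a (by simp) c (by simp) ha hc.1
    have := closed_forward P B c hc.2 hPc
      (fun x hx y hy => hcl x (List.mem_cons_of_mem _ hx) y (List.mem_cons_of_mem _ hy))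
    intro b hb
    rcases List.mem_cons.1 hb with rfl | hb
    · exact hPc
    · exact this b hb

theorem closed_all {V : Type} {G : SimpleGraph V} (P : V → Prop) (L : List V) (a : V)
    (hc : L.IsChain G.Adj) (haL : a ∈ L) (ha : P a)
    (hcl : ∀ c ∈ L, ∀ w ∈ L, P c → G.Adj c w → P w) : ∀ b ∈ L, P b := by
  obtain ⟨A, B, rfl⟩ := List.append_of_mem haL
  have h1 := closed_forward (G := G) P B a (List.isChain_append.1 hc).2.1 ha
    (fun x hx y hy => hcl x (by simp at hx ⊢; tauto) y (by simp at hy ⊢; tauto))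
  have hc' := isChain_rev.2 hc
  have h2 := closed_forward (G := G) P A.reverse a
    (by simp only [List.reverse_append, List.reverse_cons, List.append_assoc] at hc'
        exact (List.isChain_append.1 hc').2.1) ha
    (fun x hx y hy => hcl x (by simp at hx ⊢; tauto) y (by simp at hy ⊢; tauto))
  intro b hb
  simp at hb h2
  rcases hb with hb | rfl | hb
  · exact h2 b hb
  · exact ha
  · exact h1 b hb

theorem chain_of_clique {V : Type} {G : SimpleGraph V} {L : List V} (hn : L.Nodup)
    (h : ∀ a ∈ L, ∀ b ∈ L, a ≠ b → G.Adj a b) : L.IsChain G.Adj := by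
  apply List.Pairwise.isChain
  rw [List.nodup_iff_pairwise_ne] at hn
  exact List.Pairwise.imp_of_mem (fun ha hb hab => h _ ha _ hb hab) hn

theorem caseA {V : Type} {G : SimpleGraph V}
    (hclaw : RFree G claw) (hP5 : RFree G (pathGraph 5)) {l : List V} (hl : CycL G l)
    (hno : ∀ l', CycL G l' → l'.length ≠ l.length + 1)
    {x u v : V} (hx : x ∉ l) (hu : u ∈ l) (hv : v ∈ l) (huv : u ≠ v)
    (hxu : G.Adj x u) (hxv : G.Adj x v) : False := by
  obtain ⟨A, B, rfl⟩ := List.append_of_mem hu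
  replace hl := hl.rotate
  replace hno : ∀ l', CycL G l' → l'.length ≠ ((u :: B) ++ A).length + 1 := by
    intro l' h; have := hno l' h; simp at this ⊢; omega
  replace hx : x ∉ (u :: B) ++ A := by simp at hx ⊢; tauto
  replace hv : v ∈ B ++ A := by simp at hv ⊢; grind
  clear hu
  rw [List.cons_append] at hl hno hx
  generalize B ++ A = L at *
  clear A B
  obtain ⟨P1, v, P2, rfl, hxv, hP2⟩ := exists_last (G.Adj x) L ⟨v, hv, hxv⟩
  clear huv hv
  obtain ⟨hn, hc, hcl⟩ := hl
  -- insertion arguments rely on the following reformulation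
  have hn2 : (x :: u :: (P1 ++ v :: P2)).Nodup := List.nodup_cons.2 ⟨hx, hn⟩
  have build : ∀ l', List.Perm l' (x :: u :: (P1 ++ v :: P2)) → l'.IsChain G.Adj →
      (∀ a ∈ l'.getLast?, ∀ b ∈ l'.head?, G.Adj a b) → False := by
    intro l' h1 h2 h3
    exact hno l' ⟨h1.nodup_iff.2 hn2, h2, h3⟩ (by rw [h1.length_eq]; simp)
  have hP1ne : P1 ≠ [] := by
    rintro rfl
    refine build (u :: x :: v :: P2) (List.Perm.swap _ _ _) ?_ ?_
    · simp at hc ⊢; exact ⟨hxu.symm, hxv, hc.2⟩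
    · simpa [List.getLast?_cons] using hcl
  have hP2ne : P2 ≠ [] := by
    rintro rfl
    refine build (x :: u :: (P1 ++ [v])) (List.Perm.refl _) ?_ ?_
    · rw [List.isChain_cons_cons]; exact ⟨hxu, hc⟩
    · simp [List.getLast?_cons, hxv.symm]
  obtain ⟨p, hp⟩ : ∃ p, P1.head? = some p := by cases P1 <;> simp_all
  obtain ⟨q, hq⟩ : ∃ q, P1.getLast? = some q := by
    exact ⟨_, List.getLast?_eq_some_getLast hP1ne⟩
  obtain ⟨r, hr⟩ : ∃ r, P2.head? = some r := by cases P2 <;> simp_all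
  obtain ⟨s, hs⟩ : ∃ s, P2.getLast? = some s := by
    exact ⟨_, List.getLast?_eq_some_getLast hP2ne⟩
  have hpm : p ∈ P1 := List.mem_of_head? hp
  have hqm : q ∈ P1 := List.mem_of_getLast? hq
  have hrm : r ∈ P2 := List.mem_of_head? hr
  have hsm : s ∈ P2 := List.mem_of_getLast? hs
  simp [List.isChain_cons, List.isChain_append, hp, hq, hr, hs, List.getLast?_cons] at hc hcl
  obtain ⟨hup, hc1, ⟨hvr, hc2⟩, hqv⟩ := hc
  have hc2r := isChain_rev.2 hc2
  simp [List.nodup_append] at hn hx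
  obtain ⟨⟨hu1, huv, hu2⟩, hn1, ⟨hv2, hn3⟩, hd⟩ := hn
  have hxp : ¬ G.Adj x p := by
    intro h
    refine build (u :: x :: (P1 ++ v :: P2)) (List.Perm.swap _ _ _) ?_ ?_
    · simp [List.isChain_cons, List.isChain_append, hp, hq, hr, hs, *, hxu.symm]
    · simp [List.getLast?_cons, hs, hcl]
  have hxq : ¬ G.Adj x q := by
    intro h
    refine build (u :: (P1 ++ x :: v :: P2)) ?_ ?_ ?_
    · refine List.Perm.trans (List.Perm.cons u List.perm_middle) (List.Perm.swap _ _ _)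
    · simp [List.isChain_cons, List.isChain_append, hp, hq, hr, hs, *, h.symm]
    · simp [List.getLast?_cons, hs, hcl]
  have hxr := hP2 r hrm
  have hxs := hP2 s hsm
  have cl : ∀ {c a b : V}, G.Adj x c → G.Adj c a → G.Adj c b → a ≠ b → x ≠ a → x ≠ b →
      ¬ G.Adj x a → ¬ G.Adj x b → G.Adj a b := by
    intro c a b h1 h2 h3 h4 h5 h6 h7 h8
    have := claw_use hclaw h1.symm h2 h3 h5 h6 h4
    tauto
  have hxp' : x ≠ p := by rintro rfl; exact hx.2.1 hpm
  have hxq' : x ≠ q := by rintro rfl; exact hx.2.1 hqm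
  have hx2 : ∀ w ∈ P2, x ≠ w := by rintro w hw rfl; exact hx.2.2.2 hw
  have hqr : G.Adj q r := cl hxv hqv.symm hvr (hd q hqm |>.2 r hrm) hxq' (hx2 r hrm) hxq hxr
  have hpr : ¬ G.Adj p r := by
    intro h
    refine build (x :: u :: (P2.reverse ++ (P1 ++ [v]))) ?_ ?_ ?_
    · refine List.Perm.cons _ (List.Perm.cons _ ?_)
      classical
      rw [List.perm_iff_count]
      intro t
      simp only [List.count_append, List.count_cons, List.count_reverse, List.count_nil]
      omega
    · simp [List.isChain_cons, List.isChain_append, hp, hq, hr, hs, *, h.symm, hcl.symm]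
    · simp [List.getLast?_cons, hxv.symm]
  have hpv : ¬ G.Adj p v := fun h => hpr
    (cl hxv h.symm hvr (hd p hpm |>.2 r hrm) hxp' (hx2 r hrm) hxp hxr)
  have hur : ¬ G.Adj u r := fun h => hpr
    (cl hxu hup h (hd p hpm |>.2 r hrm) hxp' (hx2 r hrm) hxp hxr)
  have huv' : G.Adj u v := by
    by_contra h
    exact p5_use hP5 hup.symm hxu.symm hxv hvr (fun h => hxp h.symm) hpv hpr h hur hxr
  have main : ∀ (S : List V) (w : V) (T : List V), P2 = S ++ w :: T →
      G.Adj v w ∧ ¬ G.Adj u w ∧ ¬ G.Adj p w := by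
    intro S
    induction S using List.reverseRecOn with
    | nil =>
      intro w T h
      have : w = r := by rw [h] at hr; simpa using hr
      subst this
      exact ⟨hvr, hur, hpr⟩
    | append_singleton S' w' ih =>
      intro w T h
      obtain ⟨i1, i2, i3⟩ := ih w' (w :: T) (by simp [h])
      have hwm : w ∈ P2 := by simp [h]
      have hpw : ¬ G.Adj p w := by
        intro hpw
        refine build (x :: u :: ((w :: T).reverse ++ (P1 ++ ((S' ++ [w']) ++ [v])))) ?_ ?_ ?_
        · refine List.Perm.cons _ (List.Perm.cons _ ?_)
          rw [h]
          classical
          rw [List.perm_iff_count]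
          intro t
          simp only [List.count_append, List.count_cons, List.count_reverse, List.count_nil]
          omega
        · have e1 : (w :: T).getLast? = some s := by rw [h] at hs; simpa using hs
          have e2 : (S' ++ [w']).head? = some r := by rw [h] at hr; simpa using hr
          have e3 : (S' ++ [w']).getLast? = some w' := by simp
          have hc2' := hc2
          rw [h] at hc2'
          have f1 := (List.isChain_append.1 hc2').1
          have f2 := isChain_rev.2 (List.isChain_append.1 hc2').2.1
          have e4 : (w :: T).head? = some w := rfl
          generalize w :: T = WT at *
          generalize S' ++ [w'] = SW at *
          simp [List.isChain_cons, List.isChain_append, hp, hq, e1, e2, e3, e4, hxu, hcl.symm,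
            f1, f2, hc1, hpw.symm, hqr, i1.symm]
        · simp [List.getLast?_cons, hxv.symm]
      have huw : ¬ G.Adj u w := fun h => hpw
        (cl hxu hup h (hd p hpm |>.2 w hwm) hxp' (hx2 w hwm) hxp (hP2 w hwm))
      refine ⟨?_, huw, hpw⟩
      by_contra hvw
      have hww : G.Adj w' w := by
        rw [h] at hc2
        have := (List.isChain_append.1 hc2).2.2
        exact this w' (by simp) w (by simp)
      exact p5_use hP5 hup.symm huv' i1 hww hpv i3 hpw i2 huw hvw
  obtain ⟨S, hS⟩ : ∃ S, P2 = S ++ [s] := by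
    refine ⟨P2.dropLast, ?_⟩
    exact (List.dropLast_append_getLast? s hs).symm
  exact (main S s [] hS).2.1 hcl.symm

theorem caseB {V : Type} [Fintype V] {G : SimpleGraph V} (h2 : TwoConnected G)
    (hclaw : RFree G claw) (hP5 : RFree G (pathGraph 5)) {l : List V} (hl : CycL G l)
    (h3 : 3 ≤ l.length) (hlt : l.length < Fintype.card V)
    (hno : ∀ l', CycL G l' → l'.length ≠ l.length + 1)
    (hB : ∀ x ∉ l, ∀ u ∈ l, ∀ v ∈ l, G.Adj x u → G.Adj x v → u = v) : False := by
  classical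
  obtain ⟨z, hz⟩ : ∃ z, z ∉ l := by
    by_contra! h
    have : (Finset.univ : Finset V) ⊆ l.toFinset := fun a _ => by simp [h a]
    have := Finset.card_le_card this
    have h' := l.toFinset_card_le
    rw [Finset.card_univ] at this
    omega
  obtain ⟨u0, u1, hu0, hu1, h01⟩ : ∃ u0 u1, u0 ∈ l ∧ u1 ∈ l ∧ u1 ≠ u0 := by
    match l, h3 with
    | a :: b :: L, _ =>
      exact ⟨a, b, by simp, by simp, by have := hl.1; simp at this; tauto⟩
  obtain ⟨u, x0, hu, hx0, -, -, hux0⟩ := cut_edge h2 u0 (· ∈ l) (a := u1) (b := z) hu1 hz h01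
    (by rintro rfl; exact hz hu0)
  -- two cycle neighbours of `u`
  obtain ⟨s, t, hs, ht, hst, hus, hut⟩ : ∃ s t, s ∈ l ∧ t ∈ l ∧ s ≠ t ∧ G.Adj u s ∧ G.Adj u t := by
    obtain ⟨A, B, rfl⟩ := List.append_of_mem hu
    have hr := hl.rotate
    have hlen : 2 ≤ (B ++ A).length := by simp at h3 ⊢; omega
    have hmem : ∀ w ∈ B ++ A, w ∈ A ++ u :: B := by intro w; simp; tauto
    rw [List.cons_append] at hr
    generalize B ++ A = L at *
    obtain ⟨hn, hc, hcl⟩ := hr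
    match L, hlen with
    | a :: b :: L, _ =>
      have hne : b :: L ≠ [] := by simp
      refine ⟨a, (b :: L).getLast hne, hmem _ (by simp),
        hmem _ (List.mem_cons_of_mem _ (List.getLast_mem hne)), ?_, ?_, ?_⟩
      · intro h
        have := List.getLast_mem hne
        rw [← h] at this
        exact (List.nodup_cons.1 (List.nodup_cons.1 hn).2).1 this
      · rw [List.isChain_cons_cons] at hc; exact hc.1
      · refine (hcl _ ?_ u (by simp)).symm
        rw [List.getLast?_cons_cons, List.getLast?_cons_cons]
        simp [List.getLast?_eq_some_getLast hne]
  obtain ⟨x, y, v, hx, hy, hv, hvu, hux, hxy, hyv⟩ : ∃ x y v, x ∉ l ∧ y ∉ l ∧ v ∈ l ∧ v ≠ u ∧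
      G.Adj u x ∧ G.Adj x y ∧ G.Adj y v := by
    by_contra! hcon
    obtain ⟨b, hb, hbu⟩ : ∃ b ∈ l, b ≠ u := ⟨s, hs, hus.ne'⟩
    obtain ⟨c, d, ⟨hc, hc2⟩, hd, hcu, hdu, hcd⟩ := cut_edge h2 u
      (fun w => w ∉ l ∧ (G.Adj u w ∨ ∃ x, x ∉ l ∧ G.Adj u x ∧ G.Adj x w)) (a := x0) (b := b)
      ⟨hx0, Or.inl hux0⟩ (fun h => h.1 hb) hux0.ne' hbu
    simp only [not_and, not_or, not_exists] at hd
    have hcl' : d ∉ l := by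
      intro hdl
      rcases hc2 with h | ⟨x, hx, h1, h2⟩
      · exact hdu (hB c hc d hdl u hu hcd h.symm)
      · exact hcon x c d hx hc hdl hdu h1 h2 hcd
    obtain ⟨hd1, hd2⟩ := hd hcl'
    have huc : ¬ G.Adj u c := fun h => hd2 c hc h hcd
    obtain ⟨x, hx, h1, h2⟩ := hc2.resolve_left huc
    have fin : ∀ w ∈ l, G.Adj u w → ¬ G.Adj d w → False := by
      intro w hw huw hdw
      refine p5_use hP5 huw.symm h1 h2 hcd ?_ ?_ ?_ huc hd1 (hd2 x hx h1)
      · intro h; exact huw.ne' (hB x hx w hw u hu h.symm h1.symm)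
      · intro h; exact hcon x c w hx hc hw huw.ne' h1 h2 h.symm
      · intro h; exact hdw h.symm
    by_cases hds : G.Adj d s
    · exact fin t ht hut (fun h => hst (hB d hcl' s hs t ht hds h))
    · exact fin s hs hus hds
  have hxw : ∀ w ∈ l, G.Adj x w → w = u := fun w hw h => hB x hx w hw u hu h hux.symm
  have hyw : ∀ w ∈ l, G.Adj y w → w = v := fun w hw h => hB y hy w hw v hv h hyv
  have hyu : ¬ G.Adj y u := fun h => hvu (hyw u hu h).symm
  have Ku : ∀ a ∈ l, ∀ b ∈ l, G.Adj u a → G.Adj u b → a ≠ b → G.Adj a b := by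
    intro a ha b hb h1 h2 hab
    rcases claw_use hclaw hux h1 h2 (by rintro rfl; exact hx ha) (by rintro rfl; exact hx hb) hab
      with h | h | h
    · exact absurd (hxw a ha h) h1.ne'
    · exact absurd (hxw b hb h) h2.ne'
    · exact h
  have Kv : ∀ a ∈ l, ∀ b ∈ l, G.Adj v a → G.Adj v b → a ≠ b → G.Adj a b := by
    intro a ha b hb h1 h2 hab
    rcases claw_use hclaw hyv.symm h1 h2 (by rintro rfl; exact hy ha) (by rintro rfl; exact hy hb)
      hab with h | h | h
    · exact absurd (hyw a ha h) h1.ne'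
    · exact absurd (hyw b hb h) h2.ne'
    · exact h
  have five : ∀ c ∈ l, ∀ w ∈ l, G.Adj u c → c ≠ v → G.Adj c w → w ≠ u → ¬ G.Adj u w → w = v := by
    intro c hc w hw huc hcv hcw hwu huw
    by_contra hwv
    exact p5_use hP5 hxy.symm hux.symm huc hcw hyu (fun h => hcv (hyw c hc h))
      (fun h => hwv (hyw w hw h)) (fun h => huc.ne' (hxw c hc h)) (fun h => hwu (hxw w hw h)) huw
  have hxyne := hxy.ne
  by_cases huv : G.Adj u v
  · have all : ∀ b ∈ l, b = u ∨ G.Adj u b := by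
      refine closed_all (G := G) (fun b => b = u ∨ G.Adj u b) l u hl.2.1 hu (Or.inl rfl) ?_
      intro c hcL w hw hcu hcw
      rcases hcu with rfl | huc
      · exact Or.inr hcw
      · by_contra! hcon
        by_cases hcv : c = v
        · subst hcv
          exact hcon.2 (Kv u hu w hw huv.symm hcw hcon.1.symm)
        · have := five c hcL w hw huc hcv hcw hcon.1 hcon.2
          subst this
          exact hcon.2 huv
    have clq : ∀ a ∈ l, ∀ b ∈ l, a ≠ b → G.Adj a b := by
      intro a ha b hb hab
      rcases all a ha with rfl | h1
      · rcases all b hb with rfl | h2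
        · exact absurd rfl hab
        · exact h2
      · rcases all b hb with rfl | h2
        · exact h1.symm
        · exact Ku a ha b hb h1 h2 hab
    have pm : List.Perm l (u :: v :: (l.erase u).erase v) :=
      (List.perm_cons_erase hu).trans
        (List.Perm.cons _ (List.perm_cons_erase ((List.mem_erase_of_ne hvu).2 hv)))
    generalize (l.erase u).erase v = R at pm
    match R, pm with
    | [], pm => have := pm.length_eq; simp at this; omega
    | c :: D, pm =>
      have hn := pm.nodup_iff.1 hl.1
      have hmem : ∀ w, w ∈ l ↔ w ∈ u :: v :: c :: D := fun w => pm.mem_iff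
      have hlen := pm.length_eq
      have hsub : ∀ w ∈ u :: (D ++ [v]), w ∈ l := by intro w hw; rw [hmem]; simp at hw ⊢; tauto
      have hn1 : (u :: (D ++ [v])).Nodup := by
        clear * - hn; simp [List.nodup_append] at hn ⊢; grind
      have ch : (u :: (D ++ [v])).IsChain G.Adj := chain_of_clique hn1
        (fun a ha b hb => clq a (hsub a ha) b (hsub b hb))
      refine hno (y :: x :: (u :: (D ++ [v]))) ⟨?_, ?_, ?_⟩ ?_
      · refine List.nodup_cons.2 ⟨?_, List.nodup_cons.2 ⟨fun h => hx (hsub x h), hn1⟩⟩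
        intro h
        rcases List.mem_cons.1 h with h | h
        · exact hxyne h.symm
        · exact hy (hsub y h)
      · rw [List.isChain_cons_cons, List.isChain_cons_cons]
        exact ⟨hxy.symm, hux.symm, ch⟩
      · simp [List.getLast?_cons, hyv.symm]
      · simp at hlen ⊢; omega
  · obtain ⟨A, B, hAB⟩ := List.append_of_mem hv
    have hr : CycL G (v :: (B ++ A)) := by
      have := hl; rw [hAB] at this; exact this.rotate
    have hmem : ∀ w, w ∈ l ↔ w ∈ v :: (B ++ A) := by intro w; rw [hAB]; simp; tauto
    have hlen : l.length = (v :: (B ++ A)).length := by rw [hAB]; simp; omega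
    clear hAB
    generalize B ++ A = L at *
    obtain ⟨hn, hc, hcl⟩ := hr
    have hvL := (List.nodup_cons.1 hn).1
    have hLl : ∀ w ∈ L, w ∈ l := fun w hw => (hmem w).2 (List.mem_cons_of_mem _ hw)
    have huL : u ∈ L := (List.mem_cons.1 ((hmem u).1 hu)).resolve_left hvu.symm
    have all : ∀ b ∈ L, b = u ∨ G.Adj u b := by
      refine closed_all (G := G) (fun b => b = u ∨ G.Adj u b) L u hc.tail huL (Or.inl rfl) ?_
      intro c hcL w hw hcu hcw
      rcases hcu with rfl | huc
      · exact Or.inr hcw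
      · by_contra! hcon
        have := five c (hLl c hcL) w (hLl w hw) huc (by rintro rfl; exact hvL hcL) hcw hcon.1 hcon.2
        subst this
        exact hvL hw
    have clq : ∀ a ∈ L, ∀ b ∈ L, a ≠ b → G.Adj a b := by
      intro a ha b hb hab
      rcases all a ha with rfl | h1
      · rcases all b hb with rfl | h2
        · exact absurd rfl hab
        · exact h2
      · rcases all b hb with rfl | h2
        · exact h1.symm
        · exact Ku a (hLl a ha) b (hLl b hb) h1 h2 hab
    match L, hc with
    | p :: L', hc =>
      have hvp : G.Adj v p := (List.isChain_cons_cons.1 hc).1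
      have hpu : u ≠ p := by rintro rfl; exact huv hvp.symm
      obtain ⟨A, B, rfl⟩ := List.append_of_mem ((List.mem_cons.1 huL).resolve_left hpu)
      match B with
      | [] =>
        exact huv (hcl u (by simp [List.getLast?_cons]) v (by simp))
      | b :: B' =>
        have hsub : ∀ w ∈ u :: (A ++ B' ++ [p]), w ∈ p :: (A ++ u :: b :: B') := by
          intro w hw; simp at hw ⊢; tauto
        have hn1 : (u :: (A ++ B' ++ [p])).Nodup := by
          refine List.Nodup.of_cons (a := b) (List.Nodup.of_cons (a := v) ?_)
          refine List.Perm.nodup ?_ hn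
          clear * -
          refine List.Perm.cons _ ?_
          classical
          rw [List.perm_iff_count]
          intro t
          simp only [List.count_append, List.count_cons, List.count_reverse, List.count_nil]
          omega
        have ch : (u :: (A ++ B' ++ [p])).IsChain G.Adj := chain_of_clique hn1
          (fun a ha b hb => clq a (hsub a ha) b (hsub b hb))
        refine hno (v :: y :: x :: (u :: (A ++ B' ++ [p]))) ⟨?_, ?_, ?_⟩ ?_
        · refine List.nodup_cons.2 ⟨?_, List.nodup_cons.2 ⟨?_,
            List.nodup_cons.2 ⟨fun h => hx (hLl x (hsub x h)), hn1⟩⟩⟩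
          · intro h
            rcases List.mem_cons.1 h with h | h
            · exact hyv.ne h.symm
            rcases List.mem_cons.1 h with h | h
            · subst h; exact hx hv
            · exact hvL (hsub v h)
          · intro h
            rcases List.mem_cons.1 h with h | h
            · exact hxyne h.symm
            · exact hy (hLl y (hsub y h))
        · rw [List.isChain_cons_cons, List.isChain_cons_cons, List.isChain_cons_cons]
          exact ⟨hyv.symm, hxy.symm, hux.symm, ch⟩
        · simp [List.getLast?_cons, hvp.symm]
        · simp at hlen ⊢; omega

theorem exists_triangle {V : Type} [Fintype V] (G : SimpleGraph V)
    [DecidableRel G.Adj] (h2 : TwoConnected G) (hnc : ¬ IsCycleGraph G)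
    (hclaw : RFree G claw) : ∃ l, CycL G l ∧ l.length = 3 := by
  classical
  have third : ∀ a b : V, ∃ c, c ≠ a ∧ c ≠ b := by
    intro a b
    by_contra! h
    have : (Finset.univ : Finset V) ⊆ {a, b} := fun c _ => by
      by_cases hc : c = a
      · simp [hc]
      · simp [h c hc]
    have := Finset.card_le_card this
    have h' := Finset.card_le_two (a := a) (b := b)
    rw [Finset.card_univ] at this
    have := h2.1
    omega
  have hconn : G.Connected := by
    have : Nonempty V := Fintype.card_pos_iff.1 (by have := h2.1; omega)
    refine ⟨fun a b => ?_⟩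
    obtain ⟨c, hca, hcb⟩ := third a b
    have := (h2.2 c).preconnected ⟨a, hca.symm⟩ ⟨b, hcb.symm⟩
    exact this.map (Embedding.induce _).toHom
  have nb : ∀ v u, v ≠ u → ∃ d, d ≠ u ∧ G.Adj v d := by
    intro v u huv
    obtain ⟨b, hb1, hb2⟩ := third v u
    obtain ⟨c, d, rfl, -, -, hd, hcd⟩ := cut_edge h2 u (· = v) (a := v) (b := b) rfl hb1 huv hb2
    exact ⟨d, hd, hcd⟩
  obtain ⟨v, hv⟩ : ∃ v, G.degree v ≠ 2 := by
    by_contra! h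
    exact hnc ⟨hconn, h⟩
  obtain ⟨w, hw, -⟩ := third v v
  obtain ⟨d1, -, hd1⟩ := nb v w hw.symm
  obtain ⟨d2, hd2', hd2⟩ := nb v d1 hd1.ne
  have hdeg : 2 < G.degree v := by
    have : ({d1, d2} : Finset V) ⊆ G.neighborFinset v := by
      intro a; simp; rintro (rfl | rfl) <;> assumption
    have := Finset.card_le_card this
    rw [Finset.card_pair hd2'.symm, G.card_neighborFinset_eq_degree] at this
    omega
  rw [← G.card_neighborFinset_eq_degree, Finset.two_lt_card] at hdeg
  obtain ⟨a, ha, b, hb, c, hc, hab, hac, hbc⟩ := hdeg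
  rw [mem_neighborFinset] at ha hb hc
  have tri : ∀ a b, G.Adj v a → G.Adj v b → G.Adj a b → ∃ l, CycL G l ∧ l.length = 3 := by
    intro a b h1 h2 h3
    refine ⟨[v, a, b], ⟨?_, ?_, ?_⟩, rfl⟩
    · simp [h1.ne, h2.ne, h3.ne]
    · simp [h1, h3]
    · simp [h2.symm]
  rcases claw_use hclaw ha hb hc hab hac hbc with h | h | h
  · exact tri _ _ ha hb h
  · exact tri _ _ ha hc h
  · exact tri _ _ hb hc h

theorem pancyclic_of_claw_P5_free {V : Type} [Fintype V] (G : SimpleGraph V)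
    [DecidableRel G.Adj] (h2 : TwoConnected G) (hnc : ¬ IsCycleGraph G)
    (hclaw : RFree G claw) (hP5 : RFree G (pathGraph 5)) :
    IsPancyclic G := by
  intro k hk
  suffices h : k ≤ Fintype.card V → ∃ l, CycL G l ∧ l.length = k by
    intro hkn
    obtain ⟨l, hl, rfl⟩ := h hkn
    exact hasCycle_of_cycL hl hk
  induction k, hk using Nat.le_induction with
  | base => intro _; exact exists_triangle G h2 hnc hclaw
  | succ k hk ih =>
    intro hkn
    obtain ⟨l, hl, rfl⟩ := ih (by omega)
    by_contra! hno
    refine caseB h2 hclaw hP5 hl hk (by omega) hno ?_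
    intro x hx u hu v hv hxu hxv
    by_contra huv
    exact caseA hclaw hP5 hl hno hx hu hv huv hxu hxv
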